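/- Assume d = 2t+1, ε ≤ t + r, and that, after renumbering, α_j = α'_j and β_j = β'_j for j = 1,…,r (so α_1,…,α_r are error locators of e with corresponding error values β_1,…,β_r). Let h_0, h_1 be a free F[X]-module basis of M_0(S_y) with deg h_{00} ≥ deg h_{01} and deg h_{11} > deg h_{10}, and set w := deg h_{11} − deg h_{00} − 1. Write (ω,σ) = f_0·h_0 + f_1·h_1 with f_0, f_1 ∈ F[X]. Then f_0·h_0 + f_1·h_1 ∈ M_r(S_y; α_1,…,α_r; β_1,…,β_r), and for every nonzero (g_0,g_1) ∈ F[X]^2 with g_0·h_0 + g_1·h_1 ∈ M_r(S_y; α_1,…,α_r; β_1,…,β_r), one has lm_w(f_0,f_1) ≤_w lm_w(g_0,g_1). -/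

import Mathlib

open Polynomial

noncomputable def synd {F : Type*} [Field F] (n d : ℕ) (ta : Fin n → F) (lam : F)
    (y : Fin n → F) : F[X] :=
  ∑ j ∈ Finset.range (d - 1), C (∑ i : Fin n, ta i * y i * lam ^ ((i : ℕ) * j)) * X ^ j

/-- The module `M_r(S; α; β)` of the paper: pairs `(u,v)` with `u ≡ S v (mod X^{d-1})`,
`v(α_j⁻¹) = 0` and `β_j a_j v'(α_j⁻¹) = -α_j u(α_j⁻¹)` for all `j`. -/
def Mmod {F : Type*} [Field F] (d : ℕ) (S : F[X]) {r : ℕ} (α β a : Fin r → F) :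
    Set (F[X] × F[X]) :=
  { uv | (X : F[X]) ^ (d - 1) ∣ uv.1 - S * uv.2 ∧
      ∀ j : Fin r, uv.2.eval (α j)⁻¹ = 0 ∧
        β j * a j * ((derivative uv.2).eval (α j)⁻¹) = -(α j * uv.1.eval (α j)⁻¹) }

/-- The error-locator polynomial `σ(X) = ∏ᵢ (1 - αᵢ X)`. -/
noncomputable def elp {F : Type*} [Field F] {ε : ℕ} (α' : Fin ε → F) : F[X] :=
  ∏ i : Fin ε, (1 - C (α' i) * X)

/-- The error-evaluator polynomial `ω(X) = Σᵢ cᵢ ∏_{j≠i} (1 - αⱼ X)` (with `cᵢ = βᵢ aᵢ`). -/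
noncomputable def eep {F : Type*} [Field F] {ε : ℕ} (α' c : Fin ε → F) : F[X] :=
  ∑ i : Fin ε, C (c i) * ∏ j ∈ Finset.univ.erase i, (1 - C (α' j) * X)

/-- Degree of a polynomial, as an element of `WithBot ℤ` (so `deg 0 = ⊥ = -∞`). -/
noncomputable def degZ {F : Type*} [Field F] (p : F[X]) : WithBot ℤ :=
  p.degree.map (fun k : ℕ => (k : ℤ))

/-- The monomial ordering `<_w` on monomials of `F[X]²`: `Sum.inl i` stands for the
monomial `(X^i, 0)` and `Sum.inr j` for `(0, X^j)`. -/
def monLt (w : ℤ) : ℕ ⊕ ℕ → ℕ ⊕ ℕ → Prop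
  | Sum.inl i, Sum.inl j => i < j
  | Sum.inr i, Sum.inr j => i < j
  | Sum.inl i, Sum.inr j => (i : ℤ) ≤ (j : ℤ) + w
  | Sum.inr i, Sum.inl j => (i : ℤ) + w < (j : ℤ)

def monLe (w : ℤ) (m m' : ℕ ⊕ ℕ) : Prop := monLt w m m' ∨ m = m'

/-- The `<_w`-leading monomial of a (nonzero) pair `(u,v) ∈ F[X]²`:
`(X^{deg u}, 0)` if `deg u ≥ deg v + w + 1`, and `(0, X^{deg v})` otherwise. -/
noncomputable def lm {F : Type*} [Field F] (w : ℤ) (u v : F[X]) : ℕ ⊕ ℕ :=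
  if degZ v + (w : WithBot ℤ) + 1 ≤ degZ u then Sum.inl u.natDegree else Sum.inr v.natDegree

open Finset

section Locators

variable {F : Type*} [Field F]

lemma pow_ne_zero_and_injective_of_primitive [Fintype F] {n : ℕ} (hn : n = Fintype.card F - 1)
    {lam : F} (hlam : ∀ z : F, z ≠ 0 → ∃ k : ℕ, z = lam ^ k) :
    (∀ i : Fin n, lam ^ (i : ℕ) ≠ 0) ∧ Function.Injective fun i : Fin n => lam ^ (i : ℕ) := by
  classical
  have hcard : Fintype.card Fˣ = n := by rw [Fintype.card_units, hn]
  by_cases h0 : lam = 0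
  · have hsub : Subsingleton Fˣ := by
      have key : ∀ u : Fˣ, u = 1 := by
        intro u
        obtain ⟨k, hk⟩ := hlam u u.ne_zero
        rcases Nat.eq_zero_or_pos k with rfl | hpos
        · ext; simpa using hk
        · exact absurd (by rw [hk, h0, zero_pow hpos.ne']) u.ne_zero
      exact ⟨fun a b => by rw [key a, key b]⟩
    have h1 : n = 1 := by
      rw [← hcard]
      exact Fintype.card_eq_one_iff_nonempty_unique.2 ⟨⟨⟨1⟩, fun _ => Subsingleton.elim _ _⟩⟩
    subst h1
    exact ⟨fun i => by simp [Fin.fin_one_eq_zero i], fun i j _ => Subsingleton.elim i j⟩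
  · refine ⟨fun i => pow_ne_zero _ h0, ?_⟩
    have horder : orderOf (Units.mk0 lam h0) = n := by
      rw [← hcard, ← Nat.card_eq_fintype_card]
      refine orderOf_eq_card_of_forall_mem_zpowers fun u => ?_
      obtain ⟨k, hk⟩ := hlam u u.ne_zero
      exact ⟨k, by ext; simp [hk]⟩
    intro i j hij
    refine Fin.ext (pow_injOn_Iio_orderOf (x := Units.mk0 lam h0) ?_ ?_ ?_)
    · simp [horder]
    · simp [horder]
    · ext; simpa using hij

variable {ε : ℕ} {α c : Fin ε → F}

lemma degree_one_sub_C_mul_X {a : F} (ha : a ≠ 0) : (1 - C a * X : F[X]).degree = 1 := by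
  have h : (1 - C a * X : F[X]) = C (-a) * X + C 1 := by simp; ring
  rw [h, degree_linear (neg_ne_zero.2 ha)]

lemma degree_elp (hα : ∀ k, α k ≠ 0) : (elp α).degree = ε := by
  simp [elp, degree_prod, degree_one_sub_C_mul_X (hα _)]

lemma degree_eep_lt (hα : ∀ k, α k ≠ 0) : (eep α c).degree < ε := by
  refine (degree_sum_le _ _).trans_lt ((Finset.sup_lt_iff (WithBot.bot_lt_coe ε)).2 fun k _ => ?_)
  refine ((degree_mul_le _ _).trans (add_le_of_nonpos_left degree_C_le)).trans_lt ?_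
  have hε : 0 < ε := k.pos
  simp only [degree_prod, degree_one_sub_C_mul_X (hα _), sum_const, card_erase_of_mem (mem_univ k),
    card_univ, Fintype.card_fin, nsmul_eq_mul, mul_one]
  exact Nat.cast_lt.2 (Nat.sub_lt hε one_pos)

lemma elp_eval_inv (hα : ∀ k, α k ≠ 0) (k : Fin ε) : (elp α).eval (α k)⁻¹ = 0 := by
  rw [elp, eval_prod]
  exact prod_eq_zero (mem_univ k) (by simp [hα k])

lemma eep_eval_inv (hα : ∀ k, α k ≠ 0) (k : Fin ε) :
    (eep α c).eval (α k)⁻¹ = c k * ∏ j ∈ univ.erase k, (1 - α j * (α k)⁻¹) := by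
  rw [eep, eval_finsetSum, sum_eq_single k]
  · simp [eval_prod]
  · intro i _ hik
    rw [eval_mul, eval_prod, prod_eq_zero (mem_erase.2 ⟨hik.symm, mem_univ k⟩) (by simp [hα k]),
      mul_zero]
  · simp

lemma derivative_elp_eval_inv (hα : ∀ k, α k ≠ 0) (k : Fin ε) :
    c k * (derivative (elp α)).eval (α k)⁻¹ = -(α k * (eep α c).eval (α k)⁻¹) := by
  have h : elp α = (1 - C (α k) * X) * ∏ j ∈ univ.erase k, (1 - C (α j) * X) :=
    (mul_prod_erase univ _ (mem_univ k)).symm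
  rw [eep_eval_inv hα, h, derivative_mul]
  simp [eval_prod, hα k]
  ring

lemma eep_eval_inv_ne_zero (hα : ∀ k, α k ≠ 0) (hinj : Function.Injective α)
    (hc : ∀ k, c k ≠ 0) (k : Fin ε) : (eep α c).eval (α k)⁻¹ ≠ 0 := by
  rw [eep_eval_inv hα]
  refine mul_ne_zero (hc k) (prod_ne_zero_iff.2 fun j hj h => (mem_erase.1 hj).1 (hinj ?_))
  rw [sub_eq_zero, eq_comm, mul_inv_eq_one₀ (hα k)] at h
  exact h

lemma X_pow_dvd_eep_sub (α c : Fin ε → F) (m : ℕ) :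
    (X : F[X]) ^ m ∣
      eep α c - (∑ k, C (c k) * ∑ j ∈ range m, (C (α k) * X) ^ j) * elp α := by
  rw [eep, sum_mul, ← sum_sub_distrib]
  refine dvd_sum fun k _ => ?_
  have h : elp α = (1 - C (α k) * X) * ∏ j ∈ univ.erase k, (1 - C (α j) * X) :=
    (mul_prod_erase univ _ (mem_univ k)).symm
  have hg := mul_neg_geom_sum (C (α k) * X : F[X]) m
  refine ⟨C (c k) * C (α k) ^ m * ∏ j ∈ univ.erase k, (1 - C (α j) * X), ?_⟩
  rw [h]
  rw [mul_pow] at hg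
  linear_combination (-(C (c k) * ∏ j ∈ univ.erase k, (1 - C (α j) * X))) * hg

lemma synd_eq_sum (n d : ℕ) (ta : Fin n → F) (lam : F) (y : Fin n → F) :
    synd n d ta lam y =
      ∑ i, C (y i * ta i) * ∑ j ∈ range (d - 1), (C (lam ^ (i : ℕ)) * X) ^ j := by
  simp only [synd, map_sum, sum_mul, mul_sum]
  rw [sum_comm]
  refine sum_congr rfl fun i _ => sum_congr rfl fun j _ => ?_
  simp only [map_mul, map_pow, pow_mul, mul_pow]
  ring

lemma synd_add (n d : ℕ) (ta : Fin n → F) (lam : F) (x e : Fin n → F) :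
    synd n d ta lam (x + e) = synd n d ta lam x + synd n d ta lam e := by
  simp only [synd_eq_sum, ← sum_add_distrib, Pi.add_apply, add_mul, map_add]

lemma synd_eq_sum_locators {n : ℕ} (d : ℕ) (ta : Fin n → F) (lam : F) {e : Fin n → F}
    {loc : Fin ε → Fin n} (hloc : Function.Injective loc)
    (hsupp : ∀ i, e i ≠ 0 → ∃ k, loc k = i) :
    synd n d ta lam e = ∑ k, C (e (loc k) * ta (loc k)) *
      ∑ j ∈ range (d - 1), (C (lam ^ (loc k : ℕ)) * X) ^ j := by
  rw [synd_eq_sum]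
  refine (Fintype.sum_of_injective loc hloc _ _ (fun i hi => ?_) fun _ => rfl).symm
  have hei : e i = 0 := by_contra fun h => hi (hsupp i h)
  simp [hei]

lemma X_sub_C_sq_dvd {P : F[X]} {a : F} (h0 : P.eval a = 0) (h1 : (derivative P).eval a = 0) :
    (X - C a) ^ 2 ∣ P := by
  obtain ⟨Q, rfl⟩ := dvd_iff_isRoot.2 h0
  have hQ : Q.eval a = 0 := by simpa [derivative_mul] using h1
  rw [sq]
  exact mul_dvd_mul_left _ (dvd_iff_isRoot.2 hQ)

/-- A pair in `M_r` whose degrees are both below the number of errors vanishes. -/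
lemma eq_zero_of_mem_Mmod_of_degree_lt {t r : ℕ} {S : F[X]} {b a : Fin r → F} (hr : r ≤ ε)
    (hεtr : ε ≤ t + r) (hα : ∀ k, α k ≠ 0) (hinj : Function.Injective α) (hc : ∀ k, c k ≠ 0)
    (hba : ∀ j, b j * a j = c (Fin.castLE hr j))
    (hS : (X : F[X]) ^ (2 * t) ∣ eep α c - S * elp α) {u v : F[X]}
    (huv : (u, v) ∈ Mmod (2 * t + 1) S (fun j => α (Fin.castLE hr j)) b a)
    (hu : u.degree < ε) (hv : v.degree < ε) : u = 0 ∧ v = 0 := by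
  obtain ⟨hcong, hroot⟩ := huv
  simp only [Nat.add_sub_cancel] at hcong hroot
  set P := u * elp α - v * eep α c with hP
  have hX : (X : F[X]) ^ (2 * t) ∣ P := by
    have : P = (u - S * v) * elp α - v * (eep α c - S * elp α) := by rw [hP]; ring
    rw [this]
    exact dvd_sub (hcong.mul_right _) (hS.mul_left _)
  have hsq : ∀ j : Fin r, (X - C (α (Fin.castLE hr j))⁻¹) ^ 2 ∣ P := by
    intro j
    obtain ⟨hv0, hv1⟩ := hroot j
    have hd := derivative_elp_eval_inv (c := c) hα (Fin.castLE hr j)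
    have h0 := elp_eval_inv hα (Fin.castLE hr j)
    refine X_sub_C_sq_dvd (by simp [hP, hv0, h0]) ?_
    rw [hba] at hv1
    refine (mul_eq_zero.1 ?_).resolve_left (hc (Fin.castLE hr j))
    simp only [hP, derivative_sub, derivative_mul, eval_sub, eval_add, eval_mul, hv0, h0]
    linear_combination u.eval (α (Fin.castLE hr j))⁻¹ * hd
      - (eep α c).eval (α (Fin.castLE hr j))⁻¹ * hv1
  have hprod : ∏ j : Fin r, (X - C (α (Fin.castLE hr j))⁻¹) ^ 2 ∣ P := by
    refine Finset.prod_dvd_of_coprime (fun i _ j _ hij => IsCoprime.pow ?_) fun j _ => hsq j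
    refine isCoprime_X_sub_C_of_isUnit_sub (sub_ne_zero.2 fun h => hij ?_).isUnit
    exact Fin.castLE_injective hr (hinj (inv_injective h))
  have hdvd : X ^ (2 * t) * ∏ j : Fin r, (X - C (α (Fin.castLE hr j))⁻¹) ^ 2 ∣ P := by
    refine IsCoprime.mul_dvd (IsCoprime.prod_right fun j _ => IsCoprime.pow ?_) hX hprod
    have := isCoprime_X_sub_C_of_isUnit_sub (R := F) (a := 0) (b := (α (Fin.castLE hr j))⁻¹)
      (by simpa using hα _)
    simpa using this
  have hPdeg : P.degree < ((2 * ε : ℕ) : WithBot ℕ) := by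
    rcases Nat.eq_zero_or_pos ε with rfl | hε
    · have hu0 : u = 0 := by simpa [Nat.WithBot.lt_zero_iff] using hu
      have hv0 : v = 0 := by simpa [Nat.WithBot.lt_zero_iff] using hv
      simp [hP, hu0, hv0]
    have hω := degree_eep_lt (c := c) hα
    have hσ := degree_elp hα
    rw [two_mul, Nat.cast_add]
    refine (degree_sub_le _ _).trans_lt (max_lt ?_ ?_)
    · rw [degree_mul, hσ]
      exact WithBot.add_lt_add_right (WithBot.coe_ne_bot (a := ε)) hu
    · rw [degree_mul]
      exact (add_le_add hv.le le_rfl).trans_lt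
        (WithBot.add_lt_add_left (WithBot.coe_ne_bot (a := ε)) hω)
  have hPz : P = 0 := by
    refine eq_zero_of_dvd_of_degree_lt hdvd (hPdeg.trans_le ?_)
    simp only [degree_mul, degree_prod, degree_pow, degree_X, degree_X_sub_C, nsmul_eq_mul,
      sum_const, card_univ, Fintype.card_fin, mul_one]
    norm_cast
    omega
  have hvz : v = 0 := by
    refine eq_zero_of_degree_lt_of_eval_index_eq_zero (s := univ) (v := fun k => (α k)⁻¹)
      (fun i _ j _ h => hinj (inv_injective h)) (by simpa using hv) fun k _ => ?_
    have := congrArg (eval (α k)⁻¹) hPz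
    simp only [hP, eval_sub, eval_mul, elp_eval_inv hα, mul_zero, zero_sub, eval_zero,
      neg_eq_zero] at this
    exact (mul_eq_zero.1 this).resolve_right (eep_eval_inv_ne_zero hα hinj hc k)
  refine ⟨?_, hvz⟩
  have hσ0 : elp α ≠ 0 := fun h => by simpa [h] using degree_elp hα
  rw [hP, hvz, zero_mul, sub_zero] at hPz
  exact (mul_eq_zero.1 hPz).resolve_right hσ0

end Locators

section LeadingMonomial

variable {F : Type*} [Field F]

lemma monLe_of_not_monLt {w : ℤ} {m m' : ℕ ⊕ ℕ} (h : ¬ monLt w m' m) : monLe w m m' := by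
  rcases m with i | i <;> rcases m' with j | j <;>
    simp only [monLe, monLt, Sum.inl.injEq, Sum.inr.injEq, reduceCtorEq] at * <;> omega

lemma monLt_map {a b : ℕ} {m m' : ℕ ⊕ ℕ} (h : monLt ((b : ℤ) - a - 1) m m') :
    monLt (-1) (m.map (· + a) (· + b)) (m'.map (· + a) (· + b)) := by
  rcases m with i | i <;> rcases m' with j | j <;>
    simp only [monLt, Sum.map_inl, Sum.map_inr] at * <;> omega

lemma degZ_of_ne_zero {p : F[X]} (hp : p ≠ 0) : degZ p = ((p.natDegree : ℤ) : WithBot ℤ) := by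
  simp [degZ, degree_eq_natDegree hp]

lemma lm_eq_inl {w : ℤ} {u v : F[X]} (h : v ≠ 0 → u ≠ 0 ∧ v.natDegree + w + 1 ≤ u.natDegree) :
    lm w u v = Sum.inl u.natDegree := by
  refine if_pos ?_
  by_cases hv : v = 0
  · simp [hv, degZ]
  · obtain ⟨hu, h⟩ := h hv
    rw [degZ_of_ne_zero hu, degZ_of_ne_zero hv]
    exact_mod_cast h

lemma lm_eq_inr {w : ℤ} {u v : F[X]} (hv : v ≠ 0)
    (h : u ≠ 0 → (u.natDegree : ℤ) < v.natDegree + w + 1) :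
    lm w u v = Sum.inr v.natDegree := by
  refine if_neg ?_
  rw [degZ_of_ne_zero hv]
  by_cases hu : u = 0
  · simp [hu, degZ]
  · rw [degZ_of_ne_zero hu, not_le]
    exact_mod_cast h hu

lemma lm_neg_one_of_degree_le {u v : F[X]} (h : v.degree ≤ u.degree) :
    lm (-1) u v = Sum.inl u.natDegree := by
  refine lm_eq_inl fun hv => ?_
  have hu : u ≠ 0 := fun hu => hv (by simpa [hu] using h)
  have := natDegree_le_natDegree h
  exact ⟨hu, by omega⟩

lemma lm_neg_one_of_degree_lt {u v : F[X]} (h : u.degree < v.degree) :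
    lm (-1) u v = Sum.inr v.natDegree := by
  refine lm_eq_inr (ne_zero_of_degree_gt h) fun hu => ?_
  have := natDegree_lt_natDegree hu h
  omega

lemma degree_lt_of_monLt_inr {u v : F[X]} {k : ℕ} (h : monLt (-1) (lm (-1) u v) (Sum.inr k)) :
    u.degree < k ∧ v.degree < k := by
  rcases le_or_gt v.degree u.degree with hle | hlt
  · rw [lm_neg_one_of_degree_le hle] at h
    simp only [monLt] at h
    have hu : u.degree < k := degree_le_natDegree.trans_lt (by exact_mod_cast (by omega))
    exact ⟨hu, hle.trans_lt hu⟩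
  · rw [lm_neg_one_of_degree_lt hlt] at h
    simp only [monLt] at h
    have hv : v.degree < k := degree_le_natDegree.trans_lt (by exact_mod_cast h)
    exact ⟨hlt.trans hv, hv⟩

/-- In a basis whose first vector leads on the left and second on the right, the leading
monomial of a combination is the shift of the leading monomial of its coordinates. -/
lemma lm_combination {h00 h01 h10 h11 : F[X]} (h00ne : h00 ≠ 0) (hd0 : h01.degree ≤ h00.degree)
    (hd1 : h10.degree < h11.degree) {g0 g1 : F[X]} (hg : (g0, g1) ≠ (0, 0)) :
    lm (-1) (g0 * h00 + g1 * h10) (g0 * h01 + g1 * h11) =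
      (lm ((h11.natDegree : ℤ) - h00.natDegree - 1) g0 g1).map
        (· + h00.natDegree) (· + h11.natDegree) := by
  have h11ne : h11 ≠ 0 := ne_zero_of_degree_gt hd1
  have hle : (g0 * h01).degree ≤ (g0 * h00).degree := by
    rw [degree_mul, degree_mul]; gcongr
  have hlt : g1 ≠ 0 → (g1 * h10).degree < (g1 * h11).degree := fun hg1 => by
    rw [degree_mul, degree_mul]
    exact WithBot.add_lt_add_left (degree_ne_bot.2 hg1) hd1
  by_cases hc : (g1 * h11).degree ≤ (g0 * h00).degree
  · have hg0 : g0 ≠ 0 := by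
      rintro rfl
      exact hg (by simpa [h11ne] using hc)
    have hdeg : (g1 * h10).degree < (g0 * h00).degree := by
      by_cases hg1 : g1 = 0
      · simp [hg1, bot_lt_iff_ne_bot, hg0, h00ne]
      · exact (hlt hg1).trans_le hc
    rw [lm_eq_inl (u := g0), lm_neg_one_of_degree_le, natDegree_add_eq_left_of_degree_lt hdeg,
      natDegree_mul hg0 h00ne, Sum.map_inl]
    · rw [degree_add_eq_left_of_degree_lt hdeg]
      exact (degree_add_le _ _).trans (max_le hle hc)
    · intro hg1
      have := natDegree_le_natDegree hc
      rw [natDegree_mul hg1 h11ne, natDegree_mul hg0 h00ne] at this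
      exact ⟨hg0, by omega⟩
  · rw [not_le] at hc
    have hg1 : g1 ≠ 0 := by
      rintro rfl
      simp at hc
    have hdeg := hle.trans_lt hc
    rw [lm_eq_inr (v := g1) hg1, lm_neg_one_of_degree_lt, natDegree_add_eq_right_of_degree_lt hdeg,
      natDegree_mul hg1 h11ne, Sum.map_inr]
    · rw [degree_add_eq_right_of_degree_lt hdeg]
      exact (degree_add_le _ _).trans_lt (max_lt hc (hlt hg1))
    · intro hg0
      have := natDegree_lt_natDegree (mul_ne_zero hg0 h00ne) hc
      rw [natDegree_mul hg1 h11ne, natDegree_mul hg0 h00ne] at this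
      omega

end LeadingMonomial

/-- with `d = 2t+1`, `ε ≤ t+r`, `α₁,…,α_r` error locators with values
`β₁,…,β_r`, and `h₀, h₁` a free basis of `M₀(S_y)` as in Statement 14, writing
`(ω,σ) = f₀·h₀ + f₁·h₁`, the combination lies in `M_r(S_y; α; β)` and `lm_w(f₀,f₁)` is
`≤_w`-minimal among `lm_w(g₀,g₁)` over nonzero `(g₀,g₁)` with `g₀·h₀ + g₁·h₁ ∈ M_r`. -/
theorem stmt15 {F : Type*} [Field F] [Fintype F]
    (n d : ℕ) (hn : n = Fintype.card F - 1) (hd : 2 ≤ d)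
    (t : ℕ) (hdt : d = 2 * t + 1)
    (lam : F) (hlam : ∀ z : F, z ≠ 0 → ∃ k : ℕ, z = lam ^ k)
    (ta : Fin n → F) (hta : ∀ i, ta i ≠ 0)
    (x e y : Fin n → F) (hy : y = x + e)
    (hx : synd n d ta lam x = 0)
    (ε : ℕ) (loc : Fin ε → Fin n) (hloc : Function.Injective loc)
    (hsupp : ∀ i : Fin n, e i ≠ 0 ↔ ∃ k, loc k = i)
    (r : ℕ) (hr : r ≤ ε) (hεtr : ε ≤ t + r)
    (h00 h01 h10 h11 : F[X])
    (hm0 : (X : F[X]) ^ (d - 1) ∣ h00 - synd n d ta lam y * h01)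
    (hm1 : (X : F[X]) ^ (d - 1) ∣ h10 - synd n d ta lam y * h11)
    (hfree : ∀ u v : F[X], (X : F[X]) ^ (d - 1) ∣ u - synd n d ta lam y * v →
      ∃! fg : F[X] × F[X], u = fg.1 * h00 + fg.2 * h10 ∧ v = fg.1 * h01 + fg.2 * h11)
    (h00ne : h00 ≠ 0)
    (hd0 : h01.degree ≤ h00.degree)
    (hd1 : h10.degree < h11.degree)
    (w : ℤ) (hw : w = (h11.natDegree : ℤ) - (h00.natDegree : ℤ) - 1)
    (f0 f1 : F[X])
    (hω : eep (fun k => lam ^ ((loc k : ℕ))) (fun k => e (loc k) * ta (loc k))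
      = f0 * h00 + f1 * h10)
    (hσ : elp (fun k => lam ^ ((loc k : ℕ))) = f0 * h01 + f1 * h11) :
    (f0 * h00 + f1 * h10, f0 * h01 + f1 * h11)
        ∈ Mmod d (synd n d ta lam y)
            (fun j : Fin r => lam ^ ((loc (Fin.castLE hr j) : ℕ)))
            (fun j : Fin r => e (loc (Fin.castLE hr j)))
            (fun j : Fin r => ta (loc (Fin.castLE hr j))) ∧
      ∀ g0 g1 : F[X], (g0, g1) ≠ (0, 0) →
        (g0 * h00 + g1 * h10, g0 * h01 + g1 * h11)
            ∈ Mmod d (synd n d ta lam y)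
                (fun j : Fin r => lam ^ ((loc (Fin.castLE hr j) : ℕ)))
                (fun j : Fin r => e (loc (Fin.castLE hr j)))
                (fun j : Fin r => ta (loc (Fin.castLE hr j))) →
        monLe w (lm w f0 f1) (lm w g0 g1) := by
  obtain ⟨hne, hinj⟩ := pow_ne_zero_and_injective_of_primitive hn hlam
  set α : Fin ε → F := fun k => lam ^ (loc k : ℕ)
  set c : Fin ε → F := fun k => e (loc k) * ta (loc k)
  have hα : ∀ k, α k ≠ 0 := fun k => hne (loc k)
  have hαinj : Function.Injective α := hinj.comp hloc
  have hc : ∀ k, c k ≠ 0 := fun k => mul_ne_zero ((hsupp _).2 ⟨k, rfl⟩) (hta _)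
  have hS : (X : F[X]) ^ (d - 1) ∣ eep α c - synd n d ta lam y * elp α := by
    rw [hy, synd_add, hx, zero_add, synd_eq_sum_locators d ta lam hloc fun i => (hsupp i).1]
    exact X_pow_dvd_eep_sub α c (d - 1)
  subst hdt hw
  refine ⟨?_, fun g0 g1 hg hmem => monLe_of_not_monLt fun hlt => hg ?_⟩
  · rw [← hω, ← hσ]
    exact ⟨hS, fun j => ⟨elp_eval_inv hα _, derivative_elp_eval_inv (c := c) hα _⟩⟩
  have hf : (f0, f1) ≠ (0, 0) := by
    intro h
    obtain ⟨rfl, rfl⟩ := Prod.mk.inj h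
    have := degree_elp hα
    simp [hσ] at this
  have hσω : lm (-1) (eep α c) (elp α) = Sum.inr ε := by
    rw [lm_neg_one_of_degree_lt ((degree_eep_lt hα).trans_eq (degree_elp hα).symm),
      natDegree_eq_of_degree_eq_some (degree_elp hα)]
  have hlt' := monLt_map hlt
  rw [← lm_combination h00ne hd0 hd1 hg, ← lm_combination h00ne hd0 hd1 hf, ← hω, ← hσ,
    hσω] at hlt'
  obtain ⟨hu, hv⟩ := degree_lt_of_monLt_inr hlt'
  obtain ⟨hu0, hv0⟩ :=
    eq_zero_of_mem_Mmod_of_degree_lt hr hεtr hα hαinj hc (fun _ => rfl) hS hmem hu hv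
  exact (hfree 0 0 (by simp)).unique (y₁ := (g0, g1)) (y₂ := (0, 0)) ⟨hu0.symm, hv0.symm⟩ (by simp)
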